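/- arXiv:2112.09798 — 2 statements merged into one kernel-verified Lean document; each statement's English description precedes it below -/
import Mathlib

section
/- Let N ≥ 1, let K be a field and q ∈ K a nonzero element. The generalized q-Whittaker difference operators of type A_{N−1}^{(1)} satisfy the quantum Q-system q-commutation relations: for all a, b ∈ {1,…,N}, all k ∈ ℤ and all i ∈ {−1, 0, 1}, D_{a;k} ∘ D_{b;k+i} = q^{i·min(a,b)} · (D_{b;k+i} ∘ D_{a;k}) as K-linear endomorphisms of F = K(x_1,…,x_N). In particular (the case i = 0), for each fixed k the operators D_{1;k}, …, D_{N;k} pairwise commute. -/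
open scoped BigOperators

noncomputable section

/-- The rational function field `K(x_1, …, x_N)`, realized as the fraction field of the
polynomial ring in `N` variables over `K`. -/
abbrev RatFun (N : ℕ) (K : Type*) [Field K] : Type _ :=
  FractionRing (MvPolynomial (Fin N) K)

/-- The generator `x_i` of `K(x_1, …, x_N)`. -/
noncomputable def Xvar (N : ℕ) (K : Type*) [Field K] (i : Fin N) : RatFun N K :=
  algebraMap (MvPolynomial (Fin N) K) (RatFun N K) (MvPolynomial.X i)

/-- The generalized q-Whittaker (Macdonald) difference operator `D_{a;k}` of type
`A_{N-1}^{(1)}`, acting on `f ∈ K(x_1, …, x_N)`: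
`D_{a;k} f = ∑_{|I| = a} (∏_{i∈I} x_i^k) (∏_{i∈I} ∏_{j∉I} x_i/(x_i - x_j)) Γ_I f`,
where `Γ I` is the `K`-algebra automorphism multiplying `x_j` by `q` for `j ∈ I`. -/
noncomputable def Dwhittaker {N : ℕ} {K : Type*} [Field K]
    (Γ : Finset (Fin N) → (RatFun N K ≃ₐ[K] RatFun N K)) (a : ℕ) (k : ℤ)
    (f : RatFun N K) : RatFun N K :=
  ∑ I ∈ Finset.powersetCard a (Finset.univ : Finset (Fin N)),
    ((∏ i ∈ I, Xvar N K i ^ k) *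
        ∏ i ∈ I, ∏ j ∈ Finset.univ \ I, Xvar N K i / (Xvar N K i - Xvar N K j)) *
      Γ I f

namespace QQ
open Finset Polynomial

variable {ι L : Type*} [DecidableEq ι] [Field L]

def gg (x : ι → L) (T : L) (p : ι × ι) : L :=
  x p.1 * x p.2 / ((x p.1 - x p.2) * (x p.2 - T * x p.1))

def G (x : ι → L) (T : L) (w : Finset ι → L) (U : Finset ι) (m : ℕ) : L :=
  ∑ A ∈ powersetCard m U, w A * ∏ p ∈ A ×ˢ (U \ A), gg x T p

def GP (x : ι → L) (w : Finset ι → L) (U : Finset ι) (m : ℕ) : L[X] :=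
  ∑ A ∈ powersetCard m U,
    (C (w A * ∏ p ∈ A ×ˢ (U \ A), x p.1 * x p.2 / (x p.1 - x p.2))) *
      ∏ p ∈ U.offDiag \ (A ×ˢ (U \ A)), (C (x p.2) - C (x p.1) * X)

lemma prod_sub_offDiag {U A : Finset ι} (hA : A ⊆ U) : A ×ˢ (U \ A) ⊆ U.offDiag := by
  intro p hp
  simp only [mem_product, mem_sdiff, mem_offDiag] at hp ⊢
  refine ⟨hA hp.1, hp.2.1, fun h => hp.2.2 (h ▸ hp.1)⟩

lemma eval_good (x : ι → L) (w : Finset ι → L) (U : Finset ι) (m : ℕ) (T : L)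
    (hT : ∀ i ∈ U, ∀ j ∈ U, i ≠ j → x j - T * x i ≠ 0) :
    (GP x w U m).eval T = (∏ p ∈ U.offDiag, (x p.2 - T * x p.1)) * G x T w U m := by
  unfold GP G
  rw [eval_finsetSum, mul_sum]
  refine sum_congr rfl fun A hA => ?_
  have hs := prod_sub_offDiag (mem_powersetCard.1 hA).1
  rw [← prod_sdiff hs]
  simp only [eval_mul, eval_C, eval_prod, eval_sub, eval_X]
  have : ∏ p ∈ A ×ˢ (U \ A), x p.1 * x p.2 / (x p.1 - x p.2)
      = (∏ p ∈ A ×ˢ (U \ A), (x p.2 - T * x p.1)) * ∏ p ∈ A ×ˢ (U \ A), gg x T p := by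
    rw [← prod_mul_distrib]
    refine prod_congr rfl fun p hp => ?_
    have h := mem_offDiag.1 (hs hp)
    have h2 := hT _ h.1 _ h.2.1 h.2.2
    unfold gg
    rw [mul_comm (x p.1 - x p.2), ← div_div, mul_div_assoc', mul_div_assoc', mul_div_cancel_left₀ _ h2]
  rw [this]
  simp only [mul_comm T]
  ring

lemma natDegree_GP (x : ι → L) (w : Finset ι → L) (U : Finset ι) (m n : ℕ) (hU : U.card = m + n) :
    (GP x w U m).natDegree ≤ U.offDiag.card - m * n := by
  unfold GP
  refine natDegree_sum_le_of_forall_le _ _ fun A hA => ?_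
  have hA' := mem_powersetCard.1 hA
  have hs := prod_sub_offDiag hA'.1
  refine (natDegree_C_mul_le _ _).trans ((natDegree_prod_le _ _).trans ?_)
  have : (U.offDiag \ (A ×ˢ (U \ A))).card = U.offDiag.card - m * n := by
    rw [card_sdiff_of_subset hs, card_product, card_sdiff_of_subset hA'.1, hA'.2, hU]
    simp
  rw [← this, card_eq_sum_ones]
  refine sum_le_sum fun p _ => ?_
  compute_degree

lemma eval_root (x : ι → L) (hx : ∀ i, x i ≠ 0) (w : Finset ι → L) (U : Finset ι) (m : ℕ) (T : L)
    (hinj : Function.Injective x)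
    (u v : ι) (hu : u ∈ U) (hv : v ∈ U) (huv : u ≠ v) (hT0 : T * x u = x v)
    (hT : ∀ i ∈ U, ∀ j ∈ U, i ≠ j → (i, j) ≠ (u, v) → x j - T * x i ≠ 0) :
    (GP x w U (m+1)).eval T = (∏ p ∈ U.offDiag.erase (u, v), (x p.2 - T * x p.1))
      * (x u * x v / (x u - x v))
      * (∏ z ∈ (U.erase u).erase v, x z * x u / ((x u - x z) * (x z - x v)))
      * G x T (fun A => w (insert u A)) ((U.erase u).erase v) m := by
  have hTne : T ≠ 0 := by
    rintro rfl
    exact hx v (by rw [← hT0, zero_mul])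
  set U' := (U.erase u).erase v with hU'
  have huU' : u ∉ U' := by simp [hU']
  have hvU' : v ∉ U' := by simp [hU']
  have hUU : U = insert u (insert v U') := by
    ext z; simp only [hU', mem_insert, mem_erase]; grind
  unfold GP G
  rw [eval_finsetSum, mul_sum]
  symm
  refine sum_of_injOn (fun A => insert u A) ?_ ?_ ?_ ?_
  · intro A hA B hB hAB
    have hA' := (mem_powersetCard.1 (mem_coe.1 hA)).1
    have hB' := (mem_powersetCard.1 (mem_coe.1 hB)).1
    have h1 : u ∉ A := fun h => huU' (hA' h)
    have h2 : u ∉ B := fun h => huU' (hB' h)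
    have := congrArg (fun s => s.erase u) hAB
    simpa [erase_insert h1, erase_insert h2] using this
  · intro A hA
    have hA' := (mem_powersetCard.1 (mem_coe.1 hA))
    have h1 : u ∉ A := fun h => huU' (hA'.1 h)
    refine mem_coe.2 (mem_powersetCard.2 ⟨?_, ?_⟩)
    · rw [hUU]; exact insert_subset_insert _ (hA'.1.trans (subset_insert _ _))
    · simp [card_insert_of_notMem h1, hA'.2]
  · intro A hA hA2
    have hA' := mem_powersetCard.1 hA
    rw [eval_mul, eval_prod]
    refine mul_eq_zero_of_right _ (prod_eq_zero (i := (u, v)) ?_ ?_)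
    · simp only [mem_sdiff, mem_offDiag, mem_product]
      refine ⟨⟨hu, hv, huv⟩, fun h => hA2 ?_⟩
      refine ⟨A.erase u, ?_, insert_erase h.1⟩
      refine mem_coe.2 (mem_powersetCard.2 ⟨?_, ?_⟩)
      · intro z hz
        have hz' := mem_erase.1 hz
        rw [hU', mem_erase, mem_erase]
        exact ⟨fun h' => h.2.2 (h' ▸ hz'.2), hz'.1, hA'.1 hz'.2⟩
      · rw [card_erase_of_mem h.1, hA'.2]; rfl
    · simp only [eval_sub, eval_mul, eval_C, eval_X]
      rw [← hT0]; ring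
  · intro A hA
    have hA' := mem_powersetCard.1 hA
    have h1 : u ∉ A := fun h => huU' (hA'.1 h)
    have h1v : v ∉ A := fun h => hvU' (hA'.1 h)
    have hAU : insert u A ⊆ U := by
      rw [hUU]; exact insert_subset_insert _ (hA'.1.trans (subset_insert _ _))
    have hs := prod_sub_offDiag hAU
    have hB : U \ insert u A = insert v (U' \ A) := by
      ext z; simp only [hU', mem_insert, mem_erase, mem_sdiff]; grind
    have hvB : v ∉ U' \ A := by simp [hvU']
    have hmem : (u, v) ∈ insert u A ×ˢ (U \ insert u A) := by
      rw [hB]; simp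
    have hsplit : U.offDiag.erase (u, v) \ ((insert u A ×ˢ (U \ insert u A)).erase (u, v))
        = U.offDiag \ (insert u A ×ˢ (U \ insert u A)) := by
      ext z; simp only [mem_sdiff, mem_erase]; grind
    rw [← prod_sdiff (erase_subset_erase (u, v) hs), hsplit]
    simp only [eval_mul, eval_C, eval_prod, eval_sub, eval_X]
    have key : (∏ p ∈ (insert u A ×ˢ (U \ insert u A)).erase (u, v), (x p.2 - T * x p.1))
        * (x u * x v / (x u - x v))
        * (∏ z ∈ U', x z * x u / ((x u - x z) * (x z - x v)))
        * ∏ p ∈ A ×ˢ (U' \ A), gg x T p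
        = ∏ p ∈ insert u A ×ˢ (U \ insert u A), x p.1 * x p.2 / (x p.1 - x p.2) := by
      rw [← mul_prod_erase _ _ hmem]
      have he : (insert u A ×ˢ (U \ insert u A)).erase (u, v) =
          (A ×ˢ (U' \ A)) ∪ (A ×ˢ {v} ∪ {u} ×ˢ (U' \ A)) := by
        rw [hB]
        ext ⟨y, z⟩
        simp only [mem_erase, mem_product, mem_insert, mem_union, mem_singleton, Prod.mk.injEq, ne_eq]
        grind
      have d1 : Disjoint (A ×ˢ ({v} : Finset ι)) (({u} : Finset ι) ×ˢ (U' \ A)) := by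
        rw [disjoint_left]; rintro ⟨y, z⟩; simp only [mem_product, mem_singleton]; grind
      have d2 : Disjoint (A ×ˢ (U' \ A)) (A ×ˢ {v} ∪ {u} ×ˢ (U' \ A)) := by
        rw [disjoint_left]; rintro ⟨y, z⟩; simp only [mem_product, mem_singleton, mem_union]; grind
      rw [he, prod_union d2, prod_union d1, prod_union d2, prod_union d1, ← prod_sdiff hA'.1]
      simp only [prod_product, prod_singleton]
      have e1 : (∏ z ∈ A, (x v - T * x z)) * (∏ z ∈ A, x z * x u / ((x u - x z) * (x z - x v)))
          = ∏ z ∈ A, x z * x v / (x z - x v) := by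
        rw [← prod_mul_distrib]
        refine prod_congr rfl fun z hz => ?_
        have a1 : x u - x z ≠ 0 := sub_ne_zero.2 fun h => h1 (hinj h ▸ hz)
        have a2 : x z - x v ≠ 0 := sub_ne_zero.2 fun h => h1v (hinj h ▸ hz)
        rw [← hT0] at a2 ⊢
        field_simp
      have e2 : (∏ z ∈ U' \ A, (x z - T * x u))
            * (∏ z ∈ U' \ A, x z * x u / ((x u - x z) * (x z - x v)))
          = ∏ z ∈ U' \ A, x u * x z / (x u - x z) := by
        rw [← prod_mul_distrib]
        refine prod_congr rfl fun z hz => ?_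
        have hz' := (mem_sdiff.1 hz).1
        have a1 : x u - x z ≠ 0 := sub_ne_zero.2 fun h => huU' (hinj h ▸ hz')
        have a2 : x z - x v ≠ 0 := sub_ne_zero.2 fun h => hvU' (hinj h ▸ hz')
        rw [hT0]
        field_simp
      have e3 : (∏ y ∈ A, ∏ z ∈ U' \ A, (x z - T * x y)) * ∏ y ∈ A, ∏ z ∈ U' \ A, gg x T (y, z)
          = ∏ y ∈ A, ∏ z ∈ U' \ A, x y * x z / (x y - x z) := by
        rw [← prod_mul_distrib]
        refine prod_congr rfl fun y hy => ?_
        rw [← prod_mul_distrib]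
        refine prod_congr rfl fun z hz => ?_
        have hz' := mem_sdiff.1 hz
        have hy' := hA'.1 hy
        have hyz : y ≠ z := fun h => hz'.2 (h ▸ hy)
        have b1 : y ∈ U := by rw [hUU]; simp [hy']
        have b2 : z ∈ U := by rw [hUU]; simp [hz'.1]
        have h2 := hT y b1 z b2 hyz (by
          intro h; rw [Prod.mk.injEq] at h; exact h1 (h.1 ▸ hy))
        simp only [gg]
        rw [mul_comm (x y - x z), ← div_div, mul_div_assoc', mul_div_assoc', mul_div_cancel_left₀ _ h2]
      rw [← e1, ← e2, ← e3]
      ring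
    rw [← key]
    simp only [mul_comm T]
    ring

theorem main_id (x : ι → L) (hx : ∀ i, x i ≠ 0) (hinj : Function.Injective x)
    (H : ∀ a b c d, a ≠ b → c ≠ d → x a * x d = x b * x c → a = c ∧ b = d)
    (e : ℕ) (he : e ≤ 1) : ∀ (m n : ℕ) (U : Finset ι) (_ : U.card = m + n) (T : L)
    (_ : ∀ i ∈ U, ∀ j ∈ U, i ≠ j → x j - T * x i ≠ 0),
    G x T (fun A => ∏ j ∈ U \ A, x j ^ e) U m =
      T ^ (e * min m n) * G x T (fun A => ∏ j ∈ A, x j ^ e) U n := by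
  intro m
  induction m with
  | zero =>
    intro n U hU T hT
    have : powersetCard n U = {U} := by
      rw [show n = U.card by omega, powersetCard_self]
    simp [G, this]
  | succ m ih =>
    intro n
    cases n with
    | zero =>
      intro U hU T hT
      have : powersetCard (m+1) U = {U} := by
        rw [show m + 1 = U.card by omega, powersetCard_self]
      simp [G, this]
    | succ n =>
      intro U hU T hT
      by_cases h11 : m = 0 ∧ n = 0
      · obtain ⟨rfl, rfl⟩ := h11
        obtain ⟨a, b, hab, rfl⟩ := card_eq_two.1 hU
        have h1 := hT a (by simp) b (by simp) hab
        have h2 := hT b (by simp) a (by simp) hab.symm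
        have h3 : x a - x b ≠ 0 := sub_ne_zero.2 fun h => hab (hinj h)
        have h4 : x b - x a ≠ 0 := sub_ne_zero.2 fun h => hab (hinj h).symm
        have s1 : ({a, b} : Finset ι) \ {a} = {b} := by ext z; simp; grind
        have s2 : ({a, b} : Finset ι) \ {b} = {a} := by ext z; simp; grind
        have key : (x b - T * x a) * gg x T (a, b) + (x a - T * x b) * gg x T (b, a) = 0 := by
          simp only [gg]
          rw [mul_comm (x a - x b), ← div_div, mul_div_assoc', mul_div_assoc', mul_div_cancel_left₀ _ h1,
            mul_comm (x b - x a), ← div_div, mul_div_assoc', mul_div_assoc', mul_div_cancel_left₀ _ h2,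
            ← neg_sub (x a) (x b), div_neg]
          ring
        have hG : ∀ w, G x T w {a, b} 1 = w {a} * gg x T (a, b) + w {b} * gg x T (b, a) := by
          intro w
          simp only [G, powersetCard_one]
          simp only [sum_map, Function.Embedding.coeFn_mk]
          rw [sum_pair hab, s1, s2]
          simp
        simp only [zero_add, hG, s1, s2, prod_singleton]
        interval_cases e
        · simp
        · simp only [pow_one, min_self, mul_one]
          linear_combination key
      · have hcard : (m+1) * (n+1) > e * min (m+1) (n+1) := by
          have : e * min (m+1) (n+1) ≤ min (m+1) (n+1) := by
            simpa using Nat.mul_le_mul_right (min (m+1) (n+1)) he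
          refine lt_of_le_of_lt this ?_
          by_cases hm : m = 0
          · subst hm
            have : 0 < n := by omega
            simp; omega
          · have : 0 < m := by omega
            have h2 : min (m+1) (n+1) ≤ n + 1 := min_le_right _ _
            nlinarith
        set P : L[X] := GP x (fun A => ∏ j ∈ U \ A, x j ^ e) U (m+1) -
          X ^ (e * min (m+1) (n+1)) * GP x (fun A => ∏ j ∈ A, x j ^ e) U (n+1) with hP
        have hle : (m+1) * (n+1) ≤ U.offDiag.card := by
          rw [offDiag_card, hU]
          have : (m + 1 + (n + 1)) * (m + 1 + (n + 1)) - (m + 1 + (n + 1))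
            = (m+1+(n+1)) * (m + n + 1) := by
              rw [← Nat.mul_sub_one]; congr 1; omega
          rw [this]; nlinarith
        have hdeg : P.natDegree < U.offDiag.card := by
          have g1 := natDegree_GP x (fun A => ∏ j ∈ U \ A, x j ^ e) U (m+1) (n+1) hU
          have g2 := natDegree_GP x (fun A => ∏ j ∈ A, x j ^ e) U (n+1) (m+1) (by omega)
          rw [mul_comm (n+1)] at g2
          refine lt_of_le_of_lt (natDegree_sub_le _ _) (max_lt ?_ ?_)
          · omega
          · refine lt_of_le_of_lt natDegree_mul_le ?_
            rw [natDegree_X_pow]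
            omega
        have hP0 : P = 0 := by
          classical
          have hi : Set.InjOn (fun p : ι × ι => x p.2 / x p.1) (U.offDiag : Set (ι × ι)) := by
            rintro ⟨a, b⟩ h1 ⟨c, d⟩ h2 h
            have h1' := (mem_offDiag.1 (mem_coe.1 h1)).2.2
            have h2' := (mem_offDiag.1 (mem_coe.1 h2)).2.2
            simp only at h h1' h2'
            rw [div_eq_div_iff (hx _) (hx _)] at h
            obtain ⟨r1, r2⟩ := H b a d c h1'.symm h2'.symm (by rw [h, mul_comm])
            rw [r1, r2]
          refine eq_zero_of_natDegree_lt_card_of_eval_eq_zero' P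
            (U.offDiag.image fun p : ι × ι => x p.2 / x p.1) ?_ (by rwa [card_image_of_injOn hi])
          intro t ht
          obtain ⟨⟨u, v⟩, hp, rfl⟩ := mem_image.1 ht
          obtain ⟨hu, hv, huv⟩ := mem_offDiag.1 hp
          simp only at hu hv huv ⊢
          set T0 := x v / x u with hT0
          have hT0' : T0 * x u = x v := div_mul_cancel₀ _ (hx u)
          have hT1 : ∀ i ∈ U, ∀ j ∈ U, i ≠ j → (i, j) ≠ (u, v) → x j - T0 * x i ≠ 0 := by
            intro i _ j _ hij hne h
            rw [sub_eq_zero, hT0, div_mul_eq_mul_div, eq_div_iff (hx u)] at h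
            obtain ⟨r1, r2⟩ := H j i v u hij.symm huv.symm (by rw [h, mul_comm])
            exact hne (by rw [r1, r2])
          set U' := (U.erase u).erase v with hU'
          have huU' : u ∉ U' := by simp [hU']
          have hvU' : v ∉ U' := by simp [hU']
          have hsub : U' ⊆ U := (erase_subset _ _).trans (erase_subset _ _)
          have hcU' : U'.card = m + n := by
            rw [hU', card_erase_of_mem (mem_erase.2 ⟨huv.symm, hv⟩), card_erase_of_mem hu]; omega
          have IH := ih n U' hcU' T0 (fun i hi j hj hij => hT1 i (hsub hi) j (hsub hj) hij (by
            intro h; rw [Prod.mk.injEq] at h; exact huU' (h.1 ▸ hi)))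
          have w1 : G x T0 (fun A => ∏ j ∈ U \ insert u A, x j ^ e) U' m
              = x v ^ e * G x T0 (fun A => ∏ j ∈ U' \ A, x j ^ e) U' m := by
            unfold G
            rw [mul_sum]
            refine sum_congr rfl fun A hA => ?_
            have hA' := mem_powersetCard.1 hA
            have hB : U \ insert u A = insert v (U' \ A) := by
              have h1v : v ∉ A := fun h => hvU' (hA'.1 h)
              ext z; simp only [hU', mem_insert, mem_erase, mem_sdiff]; grind
            beta_reduce
            rw [hB, prod_insert (by simp [hvU'])]; ring
          have w2 : G x T0 (fun A => ∏ j ∈ insert u A, x j ^ e) U' n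
              = x u ^ e * G x T0 (fun A => ∏ j ∈ A, x j ^ e) U' n := by
            unfold G
            rw [mul_sum]
            refine sum_congr rfl fun A hA => ?_
            have hA' := mem_powersetCard.1 hA
            beta_reduce
            rw [prod_insert (fun h => huU' (hA'.1 h))]; ring
          rw [hP, eval_sub, eval_mul, eval_pow, eval_X,
            eval_root x hx _ U m T0 hinj u v hu hv huv hT0' hT1,
            eval_root x hx _ U n T0 hinj u v hu hv huv hT0' hT1, w1, w2, IH,
            show min (m+1) (n+1) = min m n + 1 by omega, mul_add, pow_add, mul_one, ← hT0', mul_pow]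
          ring
        have hev := congrArg (eval T) hP0
        rw [hP, eval_sub, eval_mul, eval_pow, eval_X, eval_good x _ U _ T hT,
          eval_good x _ U _ T hT, eval_zero] at hev
        have hne : ∏ p ∈ U.offDiag, (x p.2 - T * x p.1) ≠ 0 := by
          refine prod_ne_zero_iff.2 fun p hp => ?_
          obtain ⟨h1, h2, h3⟩ := mem_offDiag.1 hp
          exact hT _ h1 _ h2 h3
        refine mul_left_cancel₀ hne ?_
        linear_combination hev


def cf [Fintype ι] (x : ι → L) (k : ℤ) (I : Finset ι) : L :=
  (∏ i ∈ I, x i ^ k) * ∏ i ∈ I, ∏ j ∈ univ \ I, x i / (x i - x j)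

def gam (q : L) (x : ι → L) (I : Finset ι) (j : ι) : L := (if j ∈ I then q else 1) * x j

def Com (x : ι → L) (q : L) (r : ℤ) (S U R : Finset ι) : L :=
  (∏ i ∈ S, x i ^ r) * (∏ i ∈ S, ∏ j ∈ U, x i / (x i - x j))
    * (∏ i ∈ S, ∏ j ∈ R, x i / (x i - x j)) * (∏ i ∈ S, ∏ j ∈ R, q * x i / (q * x i - x j))
    * ∏ i ∈ U, ∏ j ∈ R, x i / (x i - x j)

lemma coef [Fintype ι] (x : ι → L) (hx : ∀ i, x i ≠ 0) (q : L) (hq : q ≠ 0) (k l : ℤ)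
    (S A B R : Finset ι)
    (hSA : Disjoint S A) (hSB : Disjoint S B) (hAB : Disjoint A B) (hR : R = univ \ (S ∪ (A ∪ B))) :
    cf x k (S ∪ A) * cf (gam q x (S ∪ A)) l (S ∪ B) =
      Com x q (k + l) S (A ∪ B) R * q ^ (l * S.card) * ((∏ i ∈ A, x i ^ k) * ∏ i ∈ B, x i ^ l)
        * ∏ p ∈ A ×ˢ B, gg x q p := by
  rw [disjoint_left] at hSA hSB hAB
  have c1 : univ \ (S ∪ A) = B ∪ R := by
    subst hR; ext z; simp only [mem_sdiff, mem_union, mem_univ, true_and]; grind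
  have c2 : univ \ (S ∪ B) = A ∪ R := by
    subst hR; ext z; simp only [mem_sdiff, mem_union, mem_univ, true_and]; grind
  have hBR : Disjoint B R := by
    subst hR; rw [disjoint_left]; intro z; simp only [mem_sdiff, mem_union, mem_univ, true_and]; grind
  have hAR : Disjoint A R := by
    subst hR; rw [disjoint_left]; intro z; simp only [mem_sdiff, mem_union, mem_univ, true_and]; grind
  have gS : ∀ i ∈ S, gam q x (S ∪ A) i = q * x i := fun i hi => by simp [gam, hi]
  have gA : ∀ i ∈ A, gam q x (S ∪ A) i = q * x i := fun i hi => by simp [gam, hi]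
  have gB : ∀ i ∈ B, gam q x (S ∪ A) i = x i := fun i hi => by
    have h1 : i ∉ S := fun h => hSB h hi
    have h2 : i ∉ A := fun h => hAB h hi
    simp [gam, h1, h2]
  have gR : ∀ i ∈ R, gam q x (S ∪ A) i = x i := fun i hi => by
    have : i ∉ S ∪ A := by
      subst hR; simp only [mem_sdiff, mem_union, mem_univ, true_and] at hi ⊢; grind
    simp only [gam, if_neg this, one_mul]
  rw [← disjoint_left] at hSA hSB hAB
  unfold cf Com
  rw [c1, c2]
  simp only [prod_union hSA, prod_union hSB, prod_union hAB, prod_union hBR, prod_union hAR,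
    prod_mul_distrib]
  have f1 : ∏ i ∈ S, gam q x (S ∪ A) i ^ l = q ^ (l * S.card) * ∏ i ∈ S, x i ^ l := by
    rw [prod_congr rfl fun i hi => by rw [gS i hi, mul_zpow], prod_mul_distrib, prod_const,
      zpow_mul, zpow_natCast]
  have f2 : ∏ i ∈ B, gam q x (S ∪ A) i ^ l = ∏ i ∈ B, x i ^ l :=
    prod_congr rfl fun i hi => by rw [gB i hi]
  have f3 : ∏ i ∈ S, ∏ j ∈ A, gam q x (S ∪ A) i / (gam q x (S ∪ A) i - gam q x (S ∪ A) j)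
      = ∏ i ∈ S, ∏ j ∈ A, x i / (x i - x j) :=
    prod_congr rfl fun i hi => prod_congr rfl fun j hj => by
      rw [gS i hi, gA j hj, ← mul_sub, mul_div_mul_left _ _ hq]
  have f4 : ∏ i ∈ S, ∏ j ∈ R, gam q x (S ∪ A) i / (gam q x (S ∪ A) i - gam q x (S ∪ A) j)
      = ∏ i ∈ S, ∏ j ∈ R, q * x i / (q * x i - x j) :=
    prod_congr rfl fun i hi => prod_congr rfl fun j hj => by
      rw [gS i hi, gR j hj]
  have f5 : ∏ i ∈ B, ∏ j ∈ R, gam q x (S ∪ A) i / (gam q x (S ∪ A) i - gam q x (S ∪ A) j)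
      = ∏ i ∈ B, ∏ j ∈ R, x i / (x i - x j) :=
    prod_congr rfl fun i hi => prod_congr rfl fun j hj => by
      rw [gB i hi, gR j hj]
  have f6 : ∏ i ∈ B, ∏ j ∈ A, gam q x (S ∪ A) i / (gam q x (S ∪ A) i - gam q x (S ∪ A) j)
      = ∏ i ∈ A, ∏ j ∈ B, x j / (x j - q * x i) := by
    rw [prod_comm]
    exact prod_congr rfl fun i hi => prod_congr rfl fun j hj => by
      rw [gB j hj, gA i hi]
  have f7 : ∏ p ∈ A ×ˢ B, gg x q p
      = (∏ i ∈ A, ∏ j ∈ B, x i / (x i - x j)) * ∏ i ∈ A, ∏ j ∈ B, x j / (x j - q * x i) := by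
    rw [prod_product, ← prod_mul_distrib]
    refine prod_congr rfl fun i _ => ?_
    rw [← prod_mul_distrib]
    refine prod_congr rfl fun j _ => ?_
    simp only [gg]
    rw [div_mul_div_comm]
  have f8 : ∏ i ∈ S, x i ^ (k + l) = (∏ i ∈ S, x i ^ k) * ∏ i ∈ S, x i ^ l := by
    rw [← prod_mul_distrib]
    exact prod_congr rfl fun i _ => zpow_add₀ (hx i) _ _
  rw [f1, f2, f3, f4, f5, f6, f7, f8]
  ring

lemma fiber [Fintype ι] (S U : Finset ι) (hd : Disjoint S U) (m n : ℕ) (hU : U.card = m + n)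
    (F : Finset ι × Finset ι → L) :
    ∑ p ∈ (powersetCard (S.card + m) (univ : Finset ι) ×ˢ powersetCard (S.card + n) univ) with
      (p.1 ∩ p.2, p.1 ∪ p.2) = (S, S ∪ U), F p
    = ∑ A ∈ powersetCard m U, F (S ∪ A, S ∪ (U \ A)) := by
  symm
  rw [disjoint_left] at hd
  refine sum_nbij' (fun A => (S ∪ A, S ∪ (U \ A))) (fun p => p.1 \ S) ?_ ?_ ?_ ?_ ?_
  · intro A hA
    obtain ⟨h1, h2⟩ := mem_powersetCard.1 hA
    simp only [mem_filter, mem_product, mem_powersetCard, subset_univ, true_and, Prod.mk.injEq]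
    refine ⟨⟨?_, ?_⟩, ?_, ?_⟩
    · rw [card_union_of_disjoint (disjoint_left.2 fun z hz hz' => hd hz (h1 hz')), h2]
    · rw [card_union_of_disjoint (disjoint_left.2 fun z hz hz' => hd hz (mem_sdiff.1 hz').1),
        card_sdiff_of_subset h1, h2, hU, Nat.add_sub_cancel_left]
    · ext z; simp only [mem_inter, mem_union, mem_sdiff]; grind
    · ext z; simp only [mem_union, mem_sdiff]; grind
  · rintro ⟨I, J⟩ hp
    simp only [mem_filter, mem_product, mem_powersetCard, subset_univ, true_and, Prod.mk.injEq] at hp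
    obtain ⟨⟨h1, h2⟩, h3, h4⟩ := hp
    have hSI : S ⊆ I := h3 ▸ inter_subset_left
    refine mem_powersetCard.2 ⟨?_, ?_⟩
    · intro z hz
      have hz' := mem_sdiff.1 hz
      have : z ∈ S ∪ U := h4 ▸ mem_union_left _ hz'.1
      exact (mem_union.1 this).resolve_left hz'.2
    · simp only [card_sdiff_of_subset hSI, h1, Nat.add_sub_cancel_left]
  · intro A hA
    obtain ⟨h1, h2⟩ := mem_powersetCard.1 hA
    ext z; simp only [mem_union, mem_sdiff]; grind
  · rintro ⟨I, J⟩ hp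
    simp only [mem_filter, mem_product, mem_powersetCard, subset_univ, true_and, Prod.mk.injEq] at hp
    obtain ⟨-, h3, h4⟩ := hp
    rw [Finset.ext_iff] at h3 h4
    simp only [mem_inter, mem_union] at h3 h4
    simp only [Prod.mk.injEq]
    constructor
    · ext z; have := h3 z; have := h4 z; simp only [mem_union, mem_sdiff]; grind
    · ext z; have := h3 z; have := h4 z; have := @hd z; simp only [mem_union, mem_sdiff]; grind
  · intro A _; rfl

/-- the combined sum over pairs -/
lemma comm_sum [Fintype ι] (x : ι → L) (hx : ∀ i, x i ≠ 0) (hinj : Function.Injective x)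
    (H : ∀ a b c d, a ≠ b → c ≠ d → x a * x d = x b * x c → a = c ∧ b = d)
    (q : L) (hq : q ≠ 0) (hT : ∀ i j, i ≠ j → x j - q * x i ≠ 0)
    (e : ℕ) (he : e ≤ 1) (a b : ℕ) (k : ℤ) (Φ : Finset ι × Finset ι → L) :
    ∑ p ∈ powersetCard a (univ : Finset ι) ×ˢ powersetCard b univ,
      cf x k p.1 * cf (gam q x p.1) (k + e) p.2 * Φ (p.1 ∩ p.2, p.1 ∪ p.2)
    = q ^ (e * min a b) * ∑ p ∈ powersetCard b (univ : Finset ι) ×ˢ powersetCard a univ,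
      cf x (k + e) p.1 * cf (gam q x p.1) k p.2 * Φ (p.1 ∩ p.2, p.1 ∪ p.2) := by
  rw [← sum_fiberwise _ (fun p => (p.1 ∩ p.2, p.1 ∪ p.2)),
    ← sum_fiberwise (powersetCard b (univ : Finset ι) ×ˢ powersetCard a univ)
      (fun p => (p.1 ∩ p.2, p.1 ∪ p.2)), mul_sum]
  refine sum_congr rfl ?_
  rintro ⟨S, V⟩ -
  by_cases hc : S ⊆ V ∧ S.card ≤ a ∧ S.card ≤ b ∧ V.card + S.card = a + b
  · obtain ⟨hSV, ha, hb, hV⟩ := hc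
    obtain ⟨m, rfl⟩ := Nat.exists_eq_add_of_le ha
    obtain ⟨n, rfl⟩ := Nat.exists_eq_add_of_le hb
    obtain ⟨U, hd, rfl⟩ : ∃ U, Disjoint S U ∧ V = S ∪ U :=
      ⟨V \ S, disjoint_sdiff, (union_sdiff_of_subset hSV).symm⟩
    have hU : U.card = m + n := by
      rw [card_union_of_disjoint hd] at hV; omega
    rw [fiber S U hd m n hU, fiber S U hd n m (by omega)]
    have e1 : ∑ A ∈ powersetCard m U, cf x k (S ∪ A) * cf (gam q x (S ∪ A)) (k + e) (S ∪ (U \ A))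
          * Φ ((S ∪ A) ∩ (S ∪ (U \ A)), (S ∪ A) ∪ (S ∪ (U \ A)))
        = Com x q (k + (k + e)) S U (univ \ (S ∪ U)) * q ^ ((k + e) * S.card) * Φ (S, S ∪ U)
          * (∏ i ∈ U, x i ^ k) * G x q (fun A => ∏ j ∈ U \ A, x j ^ e) U m := by
      unfold G
      rw [mul_sum]
      refine sum_congr rfl fun A hA => ?_
      obtain ⟨hA, -⟩ := mem_powersetCard.1 hA
      have hu : A ∪ U \ A = U := union_sdiff_of_subset hA
      rw [coef x hx q hq k (k+e) S A (U \ A) _ (hd.mono_right hA) (hd.mono_right sdiff_subset)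
        disjoint_sdiff rfl, hu, ← prod_sdiff hA,
        show (S ∪ A) ∩ (S ∪ (U \ A)) = S by
          rw [← union_inter_distrib_left, inter_sdiff_self, union_empty],
        show (S ∪ A) ∪ (S ∪ (U \ A)) = S ∪ U by
          rw [← union_union_distrib_left, hu]]
      rw [prod_congr rfl fun i (_ : i ∈ U \ A) => show x i ^ (k + (e:ℤ)) = x i ^ k * x i ^ e by
        rw [zpow_add₀ (hx i), zpow_natCast], prod_mul_distrib]
      ring
    have e2 : ∑ A ∈ powersetCard n U, cf x (k + e) (S ∪ A) * cf (gam q x (S ∪ A)) k (S ∪ (U \ A))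
          * Φ ((S ∪ A) ∩ (S ∪ (U \ A)), (S ∪ A) ∪ (S ∪ (U \ A)))
        = Com x q (k + (k + e)) S U (univ \ (S ∪ U)) * q ^ (k * S.card) * Φ (S, S ∪ U)
          * (∏ i ∈ U, x i ^ k) * G x q (fun A => ∏ j ∈ A, x j ^ e) U n := by
      unfold G
      rw [mul_sum]
      refine sum_congr rfl fun A hA => ?_
      obtain ⟨hA, -⟩ := mem_powersetCard.1 hA
      have hu : A ∪ U \ A = U := union_sdiff_of_subset hA
      rw [coef x hx q hq (k+e) k S A (U \ A) _ (hd.mono_right hA) (hd.mono_right sdiff_subset)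
        disjoint_sdiff rfl, hu, ← prod_sdiff hA, add_comm (k + (e:ℤ)) k,
        show (S ∪ A) ∩ (S ∪ (U \ A)) = S by
          rw [← union_inter_distrib_left, inter_sdiff_self, union_empty],
        show (S ∪ A) ∪ (S ∪ (U \ A)) = S ∪ U by
          rw [← union_union_distrib_left, hu]]
      rw [prod_congr rfl fun i (_ : i ∈ A) => show x i ^ (k + (e:ℤ)) = x i ^ k * x i ^ e by
        rw [zpow_add₀ (hx i), zpow_natCast], prod_mul_distrib]
      ring
    rw [e1, e2, main_id x hx hinj H e he m n U hU q (fun i _ j _ hij => hT i j hij)]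
    rw [show min (S.card + m) (S.card + n) = S.card + min m n by omega, mul_add, pow_add,
      add_mul, zpow_add₀ hq]
    have : q ^ ((e:ℤ) * (S.card : ℤ)) = q ^ (e * S.card) := by
      rw [← zpow_natCast]; push_cast; rfl
    rw [this]
    ring
  · have em : ∀ c d : ℕ, c + d = a + b → min c d = min a b →
        ((powersetCard c (univ : Finset ι) ×ˢ powersetCard d univ).filter
          fun p => (p.1 ∩ p.2, p.1 ∪ p.2) = (S, V)) = ∅ := by
      intro c d hcd hmin
      refine filter_eq_empty_iff.2 ?_
      rintro ⟨I, J⟩ hp h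
      simp only [mem_product, mem_powersetCard, subset_univ, true_and, Prod.mk.injEq] at hp h
      obtain ⟨rfl, rfl⟩ := h
      apply hc
      have h1 := card_le_card (inter_subset_left (s₁ := I) (s₂ := J))
      have h2 := card_le_card (inter_subset_right (s₁ := I) (s₂ := J))
      have h3 := card_union_add_card_inter I J
      exact ⟨inter_subset_left.trans subset_union_left, by omega, by omega, by omega⟩
    rw [em a b rfl rfl, em b a (add_comm _ _) (min_comm _ _)]
    simp

section app
variable {N : ℕ} {K : Type*} [Field K]

lemma Xvar_inj : Function.Injective (Xvar N K) := by
  intro i j h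
  exact MvPolynomial.X_injective (IsFractionRing.injective (MvPolynomial (Fin N) K) (RatFun N K) h)

lemma Xvar_ne (i : Fin N) : Xvar N K i ≠ 0 := by
  intro h
  rw [Xvar, map_eq_zero_iff _ (IsFractionRing.injective (MvPolynomial (Fin N) K) (RatFun N K))] at h
  exact MvPolynomial.X_ne_zero i h

lemma Xvar_H (a b c d : Fin N) (hab : a ≠ b) (hcd : c ≠ d)
    (h : Xvar N K a * Xvar N K d = Xvar N K b * Xvar N K c) : a = c ∧ b = d := by
  simp only [Xvar, ← map_mul] at h
  have h := IsFractionRing.injective (MvPolynomial (Fin N) K) (RatFun N K) h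
  have h1 : a = c := by
    by_contra hac
    have := congrArg (MvPolynomial.eval (fun i => if i = a then (0:K) else 1)) h
    simp [Ne.symm hab, Ne.symm hac] at this
  have h2 : b = d := by
    by_contra hbd
    have := congrArg (MvPolynomial.eval (fun i => if i = b then (0:K) else 1)) h
    simp [hab, Ne.symm hbd] at this
  exact ⟨h1, h2⟩

lemma Xvar_T (q : K) (i j : Fin N) (hij : i ≠ j) :
    Xvar N K j - algebraMap K (RatFun N K) q * Xvar N K i ≠ 0 := by
  intro h
  have hc : algebraMap K (RatFun N K) q
      = algebraMap (MvPolynomial (Fin N) K) (RatFun N K) (MvPolynomial.C q) := by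
    rw [IsScalarTower.algebraMap_apply K (MvPolynomial (Fin N) K) (RatFun N K)]
    rfl
  rw [hc, Xvar, Xvar, ← map_mul, ← map_sub,
    map_eq_zero_iff _ (IsFractionRing.injective (MvPolynomial (Fin N) K) (RatFun N K))] at h
  have := congrArg (MvPolynomial.eval (fun z => if z = i then (0:K) else 1)) h
  simp [Ne.symm hij] at this

lemma Gam_comp (q : K) (Γ : Finset (Fin N) → (RatFun N K ≃ₐ[K] RatFun N K))
    (hΓ : ∀ (I : Finset (Fin N)) (j : Fin N),
      Γ I (Xvar N K j) = (if j ∈ I then algebraMap K (RatFun N K) q else 1) * Xvar N K j)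
    (I J : Finset (Fin N)) (f : RatFun N K) :
    Γ I (Γ J f) = Γ (I ∩ J) (Γ (I ∪ J) f) := by
  have key : ((Γ I : RatFun N K →ₐ[K] RatFun N K).comp (Γ J : RatFun N K →ₐ[K] RatFun N K))
      = ((Γ (I ∩ J) : RatFun N K →ₐ[K] RatFun N K).comp
          (Γ (I ∪ J) : RatFun N K →ₐ[K] RatFun N K)) := by
    refine IsLocalization.algHom_ext (nonZeroDivisors (MvPolynomial (Fin N) K)) ?_
    refine MvPolynomial.algHom_ext fun j => ?_
    change Γ I (Γ J (Xvar N K j)) = Γ (I ∩ J) (Γ (I ∪ J) (Xvar N K j))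
    rw [hΓ, hΓ]
    by_cases h1 : j ∈ I <;> by_cases h2 : j ∈ J <;> simp [h1, h2, hΓ]
  exact DFunLike.congr_fun key f

lemma DD (q : K) (Γ : Finset (Fin N) → (RatFun N K ≃ₐ[K] RatFun N K))
    (hΓ : ∀ (I : Finset (Fin N)) (j : Fin N),
      Γ I (Xvar N K j) = (if j ∈ I then algebraMap K (RatFun N K) q else 1) * Xvar N K j)
    (a b : ℕ) (k l : ℤ) (f : RatFun N K) :
    Dwhittaker Γ a k (Dwhittaker Γ b l f) =
      ∑ p ∈ powersetCard a (univ : Finset (Fin N)) ×ˢ powersetCard b univ,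
        cf (Xvar N K) k p.1 * cf (gam (algebraMap K (RatFun N K) q) (Xvar N K) p.1) l p.2
          * (fun r : Finset (Fin N) × Finset (Fin N) => Γ r.1 (Γ r.2 f)) (p.1 ∩ p.2, p.1 ∪ p.2) := by
  rw [sum_product]
  unfold Dwhittaker
  refine sum_congr rfl fun I _ => ?_
  rw [map_sum, mul_sum]
  refine sum_congr rfl fun J _ => ?_
  simp only [map_mul, map_prod, map_zpow₀, map_div₀, map_sub, hΓ, cf, gam, Gam_comp q Γ hΓ I J]
  ring

lemma main_nat (q : K) (hq : q ≠ 0) (Γ : Finset (Fin N) → (RatFun N K ≃ₐ[K] RatFun N K))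
    (hΓ : ∀ (I : Finset (Fin N)) (j : Fin N),
      Γ I (Xvar N K j) = (if j ∈ I then algebraMap K (RatFun N K) q else 1) * Xvar N K j)
    (a b : ℕ) (k : ℤ) (e : ℕ) (he : e ≤ 1) (f : RatFun N K) :
    Dwhittaker Γ a k (Dwhittaker Γ b (k + e) f) =
      algebraMap K (RatFun N K) q ^ (e * min a b) *
        Dwhittaker Γ b (k + e) (Dwhittaker Γ a k f) := by
  rw [DD q Γ hΓ, DD q Γ hΓ]
  refine comm_sum (Xvar N K) Xvar_ne Xvar_inj Xvar_H _ ?_ (Xvar_T q) e he a b k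
    (fun r : Finset (Fin N) × Finset (Fin N) => Γ r.1 (Γ r.2 f))
  exact (_root_.map_ne_zero _).2 hq

end app

end QQ

/-- The generalized q-Whittaker difference operators of type `A_{N-1}^{(1)}` satisfy the
quantum Q-system q-commutation relations: for `a, b ∈ {1,…,N}`, `k ∈ ℤ`, `i ∈ {-1,0,1}`,
`D_{a;k} ∘ D_{b;k+i} = q^{i·min(a,b)} · D_{b;k+i} ∘ D_{a;k}`.
In particular (case `i = 0`), for fixed `k` the operators `D_{1;k}, …, D_{N;k}`
pairwise commute. -/
theorem quantum_Q_system_q_commutation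
    (N : ℕ) (hN : 1 ≤ N) (K : Type*) [Field K] (q : K) (hq : q ≠ 0)
    (Γ : Finset (Fin N) → (RatFun N K ≃ₐ[K] RatFun N K))
    (hΓ : ∀ (I : Finset (Fin N)) (j : Fin N),
      Γ I (Xvar N K j) =
        (if j ∈ I then algebraMap K (RatFun N K) q else 1) * Xvar N K j) :
    (∀ (a b : ℕ), 1 ≤ a → a ≤ N → 1 ≤ b → b ≤ N → ∀ (k i : ℤ),
        (i = -1 ∨ i = 0 ∨ i = 1) → ∀ f : RatFun N K,
        Dwhittaker Γ a k (Dwhittaker Γ b (k + i) f) =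
          algebraMap K (RatFun N K) q ^ (i * (min a b : ℤ)) *
            Dwhittaker Γ b (k + i) (Dwhittaker Γ a k f)) ∧
    (∀ (a b : ℕ), 1 ≤ a → a ≤ N → 1 ≤ b → b ≤ N → ∀ (k : ℤ) (f : RatFun N K),
        Dwhittaker Γ a k (Dwhittaker Γ b k f) =
          Dwhittaker Γ b k (Dwhittaker Γ a k f)) := by
  have hq' : algebraMap K (RatFun N K) q ≠ 0 := (map_ne_zero _).2 hq
  refine ⟨?_, ?_⟩
  · intro a b _ _ _ _ k i hi f
    rcases hi with rfl | rfl | rfl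
    · have h := QQ.main_nat q hq Γ hΓ b a (k + -1) 1 le_rfl f
      rw [show k + -1 + ((1 : ℕ) : ℤ) = k by push_cast; ring] at h
      rw [h, one_mul, min_comm b a, ← mul_assoc, ← zpow_natCast, ← zpow_add₀ hq']
      have : (-1 * (min (a : ℤ) (b : ℤ)) + ((min a b : ℕ) : ℤ)) = 0 := by push_cast; ring
      rw [this, zpow_zero, one_mul]
    · have h := QQ.main_nat q hq Γ hΓ a b k 0 (by norm_num) f
      simpa using h
    · have h := QQ.main_nat q hq Γ hΓ a b k 1 le_rfl f
      rw [← zpow_natCast] at h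
      push_cast at h
      exact h
  · intro a b _ _ _ _ k f
    have h := QQ.main_nat q hq Γ hΓ a b k 0 (by norm_num) f
    simpa using h
end
end

section
/- Let N ≥ 1 and let F = ℚ(a, b, r, t, x_1, …, x_N) be the field of rational functions in N + 4 indeterminates over ℚ; set q := r². Then the following summation identity holds in F: Σ_{i=1}^N Σ_{ε=±1} [ (1 − a x_i^{ε})(1 − b x_i^{ε})(1 − r x_i^{ε})(1 + r x_i^{ε}) / ((1 − x_i^{2ε})(1 − q x_i^{2ε})) ] · ∏_{j≠i} [ (t x_i^{ε} − x_j)/(x_i^{ε} − x_j) ] · [ (t x_i^{ε} x_j − 1)/(x_i^{ε} x_j − 1) ] = ((1 − t^N)/(1 − t)) · (1 − a b t^{N−1}). (This says that at the specialization c = q^{1/2}, d = −q^{1/2}, the scalar part of the first Koornwinder–Macdonald operator vanishes, so that the first 𝔤-Macdonald operator for 𝔤 = D_N^{(1)}, B_N^{(1)}, A_{2N−1}^{(2)} has no additive constant term.) -/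
open scoped BigOperators

noncomputable section

/-- The field `ℚ(a, b, r, t, x_1, …, x_N)` of rational functions in `N + 4`
indeterminates over `ℚ`. -/
abbrev KField (N : ℕ) : Type :=
  FractionRing (MvPolynomial (Fin 4 ⊕ Fin N) ℚ)

/-- The indeterminates of `ℚ(a, b, r, t, x_1, …, x_N)`. -/
noncomputable def gen (N : ℕ) (i : Fin 4 ⊕ Fin N) : KField N :=
  algebraMap (MvPolynomial (Fin 4 ⊕ Fin N) ℚ) (KField N) (MvPolynomial.X i)

section
open Polynomial

/-- Existence of the quotient polynomial. -/
theorem kw_exists_Q {K : Type*} [Field K] (N : ℕ) (s : Fin N → K) (t : K) (ht : t ≠ 0) :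
    ∃ Q : K[X], (∏ j, (C (t^2) * X^2 - C (s j * t) * X + 1) : K[X])
        - ∏ j, (C t * (X^2 - C (s j) * X + 1)) = (C t * X^2 - 1) * Q ∧
      Q.natDegree + 2 ≤ 2 * N + 2 * (if N = 0 then 1 else 0) ∧
      ∀ m, m + 2 = 2 * N → t * Q.coeff m = t ^ (2*N) - t ^ N := by
  have hdvd : (C t * X^2 - 1 : K[X]) ∣ (∏ j, (C (t^2) * X^2 - C (s j * t) * X + 1) : K[X])
        - ∏ j, (C t * (X^2 - C (s j) * X + 1)) := by
    have h := Ideal.Quotient.eq (I := Ideal.span {(C t * X^2 - 1 : K[X])})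
      (x := ∏ j, (C (t^2) * X^2 - C (s j * t) * X + 1))
      (y := ∏ j, (C t * (X^2 - C (s j) * X + 1)))
    rw [← Ideal.mem_span_singleton, ← h, map_prod, map_prod]
    refine Finset.prod_congr rfl fun j _ => ?_
    rw [Ideal.Quotient.eq, Ideal.mem_span_singleton]
    refine ⟨C t - 1, ?_⟩
    simp only [C_mul, C_pow]
    ring
  obtain ⟨Q, hQ⟩ := hdvd
  have hA : (∏ j, (C (t^2) * X^2 - C (s j * t) * X + 1) : K[X]).natDegree ≤ 2 * N ∧
      (∏ j, (C (t^2) * X^2 - C (s j * t) * X + 1) : K[X]).coeff (2 * N) = t ^ (2 * N) := by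
    have h1 : ∀ j, (C (t^2) * X^2 - C (s j * t) * X + 1 : K[X]).natDegree ≤ 2 := by
      intro j; compute_degree
    constructor
    · refine (natDegree_prod_le _ _).trans ((Finset.sum_le_sum fun j _ => h1 j).trans ?_)
      simp [mul_comm]
    · have := coeff_prod_of_natDegree_le Finset.univ
        (fun j => (C (t^2) * X^2 - C (s j * t) * X + 1 : K[X])) 2 (fun j _ => h1 j)
      simp only [Finset.card_univ, Fintype.card_fin] at this
      rw [mul_comm 2 N, this]
      rw [pow_mul]
      simp only [coeff_add, coeff_sub, coeff_C_mul, coeff_X_pow, coeff_X, coeff_one]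
      simp [← pow_mul, mul_comm]
  have hB : (∏ j, (C t * (X^2 - C (s j) * X + 1)) : K[X]).natDegree ≤ 2 * N ∧
      (∏ j, (C t * (X^2 - C (s j) * X + 1)) : K[X]).coeff (2 * N) = t ^ N := by
    have h1 : ∀ j, (C t * (X^2 - C (s j) * X + 1) : K[X]).natDegree ≤ 2 := by
      intro j; compute_degree
    constructor
    · refine (natDegree_prod_le _ _).trans ((Finset.sum_le_sum fun j _ => h1 j).trans ?_)
      simp [mul_comm]
    · have := coeff_prod_of_natDegree_le Finset.univ
        (fun j => (C t * (X^2 - C (s j) * X + 1) : K[X])) 2 (fun j _ => h1 j)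
      simp only [Finset.card_univ, Fintype.card_fin] at this
      rw [mul_comm 2 N, this]
      simp [coeff_X, coeff_one]
  have hd : (C t * X^2 - 1 : K[X]).natDegree = 2 := by
    compute_degree!
  have hd0 : (C t * X^2 - 1 : K[X]) ≠ 0 := by
    intro h; rw [h] at hd; simp at hd
  have hR : ((C t * X^2 - 1 : K[X]) * Q).natDegree ≤ 2 * N := by
    rw [← hQ]; exact (natDegree_sub_le _ _).trans (max_le hA.1 hB.1)
  have hQd : Q.natDegree + 2 ≤ 2 * N + 2 * (if N = 0 then 1 else 0) := by
    by_cases hQ0 : Q = 0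
    · subst hQ0
      split_ifs <;> simp <;> omega
    · rw [natDegree_mul hd0 hQ0, hd] at hR
      omega
  refine ⟨Q, hQ, hQd, ?_⟩
  intro m hm
  have h2 := congrArg (fun p => p.coeff (2 * N)) hQ
  simp only [coeff_sub, hA.2, hB.2] at h2
  rw [h2, ← hm, sub_mul, one_mul, coeff_sub, mul_assoc, coeff_C_mul, coeff_X_pow_mul,
    coeff_eq_zero_of_natDegree_lt (p := Q) (n := m + 2), sub_zero]
  split_ifs at hQd <;> omega

theorem kw_term {K : Type*} [Field K] (N : ℕ) (x : Fin N → K) (a b t : K) (Q : K[X])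
    (hQ : (∏ j, (C (t^2) * X^2 - C ((x j + (x j)⁻¹) * t) * X + 1) : K[X])
        - ∏ j, (C t * (X^2 - C (x j + (x j)⁻¹) * X + 1)) = (C t * X^2 - 1) * Q)
    (hx : ∀ i, x i ≠ 0) (i : Fin N) (y y' : K) (hy : y * y' = 1)
    (hs : y + y' = x i + (x i)⁻¹) (hty : t * y ^ 2 ≠ 1) (hy1 : y ^ 2 ≠ 1)
    (hn : ∀ j, j ≠ i → (y - x j) * (y * x j - 1) ≠ 0) :
    ((1 - C a * X) * (1 - C b * X) * Q).eval y /
      (y * (y - y') * ∏ j ∈ Finset.univ.erase i, ((y - x j) * (y - (x j)⁻¹))) =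
    (1 - t) * ((1 - a * y) * (1 - b * y) / (1 - y ^ 2) *
      ∏ j ∈ Finset.univ.erase i, ((t * y - x j) / (y - x j)) * ((t * y * x j - 1) / (y * x j - 1))) := by
  have hQy : Q.eval y = (t - 1) * ∏ j ∈ Finset.univ.erase i, ((t * y - x j) * (t * y - (x j)⁻¹)) := by
    have h := congrArg (eval y) hQ
    simp only [eval_sub, eval_prod, eval_mul, eval_add, eval_C, eval_pow, eval_X, eval_one] at h
    rw [Finset.prod_eq_zero (i := i) (Finset.mem_univ i)
      (f := fun j => t * (y ^ 2 - (x j + (x j)⁻¹) * y + 1)) (by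
        rw [← hs, ← hy]; ring), sub_zero, ← Finset.mul_prod_erase _ _ (Finset.mem_univ i), ← hs] at h
    have h3 : t * y ^ 2 - 1 ≠ 0 := sub_ne_zero.mpr hty
    apply mul_left_cancel₀ h3
    rw [← h]
    have h4 : (t ^ 2 * y ^ 2 - (y + y') * t * y + 1) = (t * y^2 - 1) * (t - 1) := by
      linear_combination (-t) * hy
    rw [h4, mul_assoc]
    congr 2
    refine Finset.prod_congr rfl fun j _ => ?_
    have := mul_inv_cancel₀ (hx j)
    linear_combination -this
  have hp : ∏ j ∈ Finset.univ.erase i, ((t * y - x j) / (y - x j)) * ((t * y * x j - 1) / (y * x j - 1))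
     = (∏ j ∈ Finset.univ.erase i, ((t * y - x j) * (t * y - (x j)⁻¹))) /
       ∏ j ∈ Finset.univ.erase i, ((y - x j) * (y - (x j)⁻¹)) := by
    rw [← Finset.prod_div_distrib]
    refine Finset.prod_congr rfl fun j hj => ?_
    have h1 := hn j (Finset.ne_of_mem_erase hj)
    have h2 := left_ne_zero_of_mul h1
    have h3 := right_ne_zero_of_mul h1
    have h0 := hx j
    have e1 : y - (x j)⁻¹ = (y * x j - 1) / x j := by field_simp
    have e2 : t * y - (x j)⁻¹ = (t * y * x j - 1) / x j := by field_simp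
    rw [e1, e2]
    field_simp
  have e : y * (y - y') = -(1 - y ^ 2) := by linear_combination -hy
  rw [hp, e]
  simp only [eval_mul, eval_sub, eval_one, eval_C, eval_X, hQy]
  have hy2 : 1 - y ^ 2 ≠ 0 := sub_ne_zero.mpr hy1.symm
  generalize ∏ j ∈ Finset.univ.erase i, ((t * y - x j) * (t * y - (x j)⁻¹)) = U
  generalize ∏ j ∈ Finset.univ.erase i, ((y - x j) * (y - (x j)⁻¹)) = V
  by_cases hV : V = 0
  · simp [hV]
  field_simp
  ring

theorem kw_main {K : Type*} [Field K] (N : ℕ) (hN : 1 ≤ N) (x : Fin N → K) (a b t : K)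
    (ht0 : t ≠ 0) (ht1 : t ≠ 1) (hx : ∀ i, x i ≠ 0) (hinj : ∀ i j, i ≠ j → x i ≠ x j)
    (hxx : ∀ i j, x i * x j ≠ 1) (htx : ∀ i, t * x i ^ 2 ≠ 1) (htx' : ∀ i, t * (x i)⁻¹ ^ 2 ≠ 1) :
    ∑ i, ((1 - a * x i) * (1 - b * x i) / (1 - x i ^ 2) *
      (∏ j ∈ Finset.univ.erase i, ((t * x i - x j) / (x i - x j)) *
        ((t * x i * x j - 1) / (x i * x j - 1))) +
      (1 - a * (x i)⁻¹) * (1 - b * (x i)⁻¹) / (1 - (x i)⁻¹ ^ 2) *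
      (∏ j ∈ Finset.univ.erase i, ((t * (x i)⁻¹ - x j) / ((x i)⁻¹ - x j)) *
        ((t * (x i)⁻¹ * x j - 1) / ((x i)⁻¹ * x j - 1)))) =
    (1 - t ^ N) / (1 - t) * (1 - a * b * t ^ (N - 1)) := by
  obtain ⟨Q, hQ, hdeg, hco⟩ := kw_exists_Q N (fun j => x j + (x j)⁻¹) t ht0
  have hN0 : N ≠ 0 := by omega
  simp only [hN0, if_false, mul_zero, add_zero] at hdeg
  have hsq : ∀ i, x i ^ 2 ≠ 1 := fun i => by rw [pow_two]; exact hxx i i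
  have hinv : ∀ i j, x i ≠ (x j)⁻¹ := fun i j h => hxx i j (by rw [h, inv_mul_cancel₀ (hx j)])
  let v : Option (Fin N ⊕ Fin N) → K := fun k => k.elim 0 (Sum.elim x fun i => (x i)⁻¹)
  have hv : Function.Injective v := by
    have hxi : Function.Injective x := fun i j h => by
      by_contra hne; exact hinj i j hne h
    rintro (_ | i | i) (_ | j | j) h <;> simp only [v, Option.elim, Sum.elim_inl, Sum.elim_inr] at h
    · rfl
    · exact absurd h.symm (hx j)
    · exact absurd h.symm (inv_ne_zero (hx j))
    · exact absurd h (hx i)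
    · rw [hxi h]
    · exact absurd h (hinv i j)
    · exact absurd h (inv_ne_zero (hx i))
    · exact absurd h.symm (hinv j i)
    · rw [hxi (inv_injective h)]
  have hcard : (Finset.univ : Finset (Option (Fin N ⊕ Fin N))).card = 2 * N + 1 := by
    simp; omega
  have hdP : ((1 - C a * X) * (1 - C b * X) : K[X]).natDegree ≤ 2 := by compute_degree
  have hL := Lagrange.coeff_eq_sum (s := Finset.univ) (v := v) hv.injOn
    (P := (1 - C a * X) * (1 - C b * X) * Q) (by
      rw [hcard]
      refine (degree_le_natDegree).trans_lt ?_
      have := natDegree_mul_le (p := ((1 - C a * X) * (1 - C b * X) : K[X])) (q := Q)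
      exact_mod_cast (by omega))
  have hprod : ∀ k, ∏ j ∈ Finset.univ.erase k, (v k - v j) =
      ∏ j, if j = k then 1 else (v k - v j) := by
    intro k
    rw [← Finset.mul_prod_erase Finset.univ _ (Finset.mem_univ k)]
    simp only [if_true, one_mul]
    exact Finset.prod_congr rfl fun j hj => by rw [if_neg (Finset.ne_of_mem_erase hj)]
  have hite : ∀ (i : Fin N) (f : Fin N → K), ∏ j, (if j = i then 1 else f j) =
      ∏ j ∈ Finset.univ.erase i, f j := by
    intro i f
    rw [← Finset.mul_prod_erase Finset.univ _ (Finset.mem_univ i)]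
    simp only [if_true, one_mul]
    exact Finset.prod_congr rfl fun j hj => by rw [if_neg (Finset.ne_of_mem_erase hj)]
  have hp1 : ∀ i, ∏ j ∈ Finset.univ.erase (some (Sum.inl i)), (v (some (Sum.inl i)) - v j) =
      x i * (x i - (x i)⁻¹) * ∏ j ∈ Finset.univ.erase i, ((x i - x j) * (x i - (x j)⁻¹)) := by
    intro i
    rw [hprod, Fintype.prod_option, Fintype.prod_sum_type, Finset.prod_mul_distrib]
    simp only [v, Option.elim, Sum.elim_inl, Sum.elim_inr, reduceCtorEq, if_false,
      Option.some.injEq, Sum.inl.injEq, sub_zero]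
    rw [hite, ← Finset.mul_prod_erase Finset.univ (fun j => x i - (x j)⁻¹) (Finset.mem_univ i)]
    ring
  have hp2 : ∀ i, ∏ j ∈ Finset.univ.erase (some (Sum.inr i)), (v (some (Sum.inr i)) - v j) =
      (x i)⁻¹ * ((x i)⁻¹ - x i) *
        ∏ j ∈ Finset.univ.erase i, (((x i)⁻¹ - x j) * ((x i)⁻¹ - (x j)⁻¹)) := by
    intro i
    rw [hprod, Fintype.prod_option, Fintype.prod_sum_type, Finset.prod_mul_distrib]
    simp only [v, Option.elim, Sum.elim_inl, Sum.elim_inr, reduceCtorEq, if_false,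
      Option.some.injEq, Sum.inr.injEq, sub_zero]
    rw [hite, ← Finset.mul_prod_erase Finset.univ (fun j => (x i)⁻¹ - x j) (Finset.mem_univ i)]
    ring
  have hp0 : ∏ j ∈ Finset.univ.erase none, (v none - v j) = 1 := by
    rw [hprod, Fintype.prod_option, Fintype.prod_sum_type, ← Finset.prod_mul_distrib]
    simp only [v, Option.elim, Sum.elim_inl, Sum.elim_inr, reduceCtorEq, if_false, if_true, one_mul,
      zero_sub]
    refine Finset.prod_eq_one fun j _ => ?_
    rw [neg_mul_neg, mul_inv_cancel₀ (hx j)]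
  have hQ0 : Q.eval 0 = t ^ N - 1 := by
    have h := congrArg (eval 0) hQ
    simp [eval_prod] at h
    linear_combination h
  obtain ⟨m, hm⟩ : ∃ m, m + 2 = 2 * N := ⟨2 * N - 2, by omega⟩
  have hcoef : ((1 - C a * X) * (1 - C b * X) * Q).coeff (2 * N) = a * b * Q.coeff m := by
    rw [← hm, add_comm m 2, coeff_mul_add_eq_of_natDegree_le hdP (by omega)]
    congr 1
    have : ((1 - C a * X) * (1 - C b * X) : K[X]) = C (a * b) * X ^ 2 - C (a + b) * X + 1 := by
      simp only [C_mul, C_add]; ring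
    rw [this]
    simp only [coeff_add, coeff_sub, coeff_C_mul, coeff_X_pow, coeff_X, coeff_one]
    simp
  rw [hcard, Nat.add_sub_cancel, hcoef, Fintype.sum_option, Fintype.sum_sum_type, hp0] at hL
  simp only [hp1, hp2] at hL
  simp only [v, Option.elim, Sum.elim_inl, Sum.elim_inr] at hL
  rw [← Finset.sum_add_distrib] at hL
  have ht1' : (1 - t) ≠ 0 := sub_ne_zero.mpr ht1.symm
  have hkey : ∀ i, _ := fun i => kw_term N x a b t Q hQ hx i (x i) (x i)⁻¹ (mul_inv_cancel₀ (hx i)) rfl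
    (htx i) (hsq i) (fun j hj => mul_ne_zero (sub_ne_zero.mpr (hinj i j hj.symm))
      (sub_ne_zero.mpr (hxx i j)))
  have hkey' : ∀ i, _ := fun i => kw_term N x a b t Q hQ hx i (x i)⁻¹ (x i) (inv_mul_cancel₀ (hx i))
    (add_comm _ _)
    (htx' i) (by rw [inv_pow]; exact fun h => hsq i (inv_eq_one.mp h))
    (fun j hj => mul_ne_zero (sub_ne_zero.mpr (hinv j i).symm)
      (sub_ne_zero.mpr (fun h => hinj i j hj.symm (by
        have := hx i
        field_simp at h
        exact h.symm))))
  simp only [hkey, hkey', ← mul_add] at hL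
  rw [← Finset.mul_sum] at hL
  have hc := hco m hm
  simp only [eval_mul, eval_sub, eval_one, eval_C, eval_X, mul_zero, sub_zero, one_mul, hQ0,
    div_one] at hL
  rw [div_mul_eq_mul_div, eq_div_iff ht1', mul_comm]
  have hco2 : Q.coeff m = t ^ (N - 1) * (t ^ N - 1) := by
    apply mul_left_cancel₀ ht0
    obtain ⟨n, rfl⟩ : ∃ n, N = n + 1 := ⟨N - 1, by omega⟩
    rw [hc, Nat.add_sub_cancel]; ring
  rw [hco2] at hL
  linear_combination -hL

end

theorem gen_poly_ne {N : ℕ} (p : MvPolynomial (Fin 4 ⊕ Fin N) ℚ) (f : Fin 4 ⊕ Fin N → ℚ)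
    (h : MvPolynomial.eval f p ≠ 0) :
    algebraMap (MvPolynomial (Fin 4 ⊕ Fin N) ℚ) (KField N) p ≠ 0 := by
  intro h0
  have : p = 0 := (IsFractionRing.injective (MvPolynomial (Fin 4 ⊕ Fin N) ℚ) (KField N))
    (h0.trans (map_zero _).symm)
  rw [this] at h
  simp at h

/-- At the specialization `c = q^{1/2}`, `d = -q^{1/2}` (with `q = r²`, `c = r`, `d = -r`),
the sum of the Koornwinder coefficient functions is the constant
`((1 - t^N)/(1 - t))(1 - a b t^{N-1})`:
`∑_{i=1}^N ∑_{ε=±1} [(1 - a x_i^ε)(1 - b x_i^ε)(1 - r x_i^ε)(1 + r x_i^ε) /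
   ((1 - x_i^{2ε})(1 - q x_i^{2ε}))] ∏_{j≠i} [(t x_i^ε - x_j)/(x_i^ε - x_j)]
   [(t x_i^ε x_j - 1)/(x_i^ε x_j - 1)] = ((1 - t^N)/(1 - t))(1 - a b t^{N-1})`,
so the first 𝔤-Macdonald operator for `𝔤 = D_N^{(1)}, B_N^{(1)}, A_{2N-1}^{(2)}`
has no additive constant term. -/
theorem koornwinder_constant_vanishes (N : ℕ) (hN : 1 ≤ N) :
    (let a : KField N := gen N (Sum.inl 0)
     let b : KField N := gen N (Sum.inl 1)
     let r : KField N := gen N (Sum.inl 2)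
     let t : KField N := gen N (Sum.inl 3)
     let q : KField N := r ^ 2
     let x : Fin N → KField N := fun i => gen N (Sum.inr i)
     ∑ i : Fin N, ∑ ε ∈ ({1, -1} : Finset ℤ),
        (1 - a * x i ^ ε) * (1 - b * x i ^ ε) * (1 - r * x i ^ ε) * (1 + r * x i ^ ε) /
            ((1 - x i ^ (2 * ε)) * (1 - q * x i ^ (2 * ε))) *
          ∏ j ∈ Finset.univ.erase i,
            ((t * x i ^ ε - x j) / (x i ^ ε - x j)) *
              ((t * x i ^ ε * x j - 1) / (x i ^ ε * x j - 1))) =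
      (let a : KField N := gen N (Sum.inl 0)
       let b : KField N := gen N (Sum.inl 1)
       let t : KField N := gen N (Sum.inl 3)
       (1 - t ^ N) / (1 - t) * (1 - a * b * t ^ (N - 1))) := by
  let a : KField N := gen N (Sum.inl 0)
  let b : KField N := gen N (Sum.inl 1)
  let r : KField N := gen N (Sum.inl 2)
  let t : KField N := gen N (Sum.inl 3)
  let x : Fin N → KField N := fun i => gen N (Sum.inr i)
  change ∑ i : Fin N, ∑ ε ∈ ({1, -1} : Finset ℤ),
        (1 - a * x i ^ ε) * (1 - b * x i ^ ε) * (1 - r * x i ^ ε) * (1 + r * x i ^ ε) /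
            ((1 - x i ^ (2 * ε)) * (1 - r ^ 2 * x i ^ (2 * ε))) *
          ∏ j ∈ Finset.univ.erase i,
            ((t * x i ^ ε - x j) / (x i ^ ε - x j)) *
              ((t * x i ^ ε * x j - 1) / (x i ^ ε * x j - 1)) =
      (1 - t ^ N) / (1 - t) * (1 - a * b * t ^ (N - 1))
  have ht0 : t ≠ 0 := gen_poly_ne (MvPolynomial.X (Sum.inl 3)) (fun _ => 1) (by simp)
  have ht1 : t ≠ 1 := by
    have := gen_poly_ne (N := N) (MvPolynomial.X (Sum.inl 3) - 1) (fun _ => 2) (by norm_num)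
    rw [map_sub, map_one] at this
    exact sub_ne_zero.mp this
  have hx : ∀ i, x i ≠ 0 := fun i =>
    gen_poly_ne (MvPolynomial.X (Sum.inr i)) (fun _ => 1) (by simp)
  have hinj : ∀ i j, i ≠ j → x i ≠ x j := fun i j hij => by
    have := gen_poly_ne (N := N) (MvPolynomial.X (Sum.inr i) - MvPolynomial.X (Sum.inr j))
      (fun k => if k = Sum.inr i then 1 else 0) (by simp [hij.symm])
    rw [map_sub] at this
    exact sub_ne_zero.mp this
  have hxx : ∀ i j, x i * x j ≠ 1 := fun i j => by
    have := gen_poly_ne (N := N) (MvPolynomial.X (Sum.inr i) * MvPolynomial.X (Sum.inr j) - 1)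
      (fun _ => 2) (by norm_num)
    rw [map_sub, map_mul, map_one] at this
    exact sub_ne_zero.mp this
  have htx : ∀ i, t * x i ^ 2 ≠ 1 := fun i => by
    have := gen_poly_ne (N := N) (MvPolynomial.X (Sum.inl 3) * MvPolynomial.X (Sum.inr i) ^ 2 - 1)
      (fun _ => 2) (by norm_num)
    rw [map_sub, map_mul, map_pow, map_one] at this
    exact sub_ne_zero.mp this
  have htx' : ∀ i, t * (x i)⁻¹ ^ 2 ≠ 1 := fun i => by
    have := gen_poly_ne (N := N) (MvPolynomial.X (Sum.inl 3) - MvPolynomial.X (Sum.inr i) ^ 2)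
      (fun _ => 2) (by norm_num)
    rw [map_sub, map_pow] at this
    have h2 : t ≠ x i ^ 2 := sub_ne_zero.mp this
    intro h
    apply h2
    have := hx i
    field_simp at h
    exact h
  have hrx : ∀ i, 1 - r ^ 2 * x i ^ 2 ≠ 0 := fun i => by
    have := gen_poly_ne (N := N)
      (1 - MvPolynomial.X (Sum.inl 2) ^ 2 * MvPolynomial.X (Sum.inr i) ^ 2)
      (fun _ => 2) (by norm_num)
    rw [map_sub, map_mul, map_pow, map_pow, map_one] at this
    exact this
  have hrx' : ∀ i, 1 - r ^ 2 * (x i)⁻¹ ^ 2 ≠ 0 := fun i => by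
    have := gen_poly_ne (N := N)
      (MvPolynomial.X (Sum.inr i) ^ 2 - MvPolynomial.X (Sum.inl 2) ^ 2)
      (fun k => if k = Sum.inr i then 1 else 0) (by simp)
    rw [map_sub, map_pow, map_pow] at this
    have h2 : x i ^ 2 - r ^ 2 ≠ 0 := this
    intro h
    apply h2
    have := hx i
    field_simp at h
    rw [h, mul_zero]
  have hcancel : ∀ y : KField N, 1 - r ^ 2 * y ^ 2 ≠ 0 →
      (1 - a * y) * (1 - b * y) * (1 - r * y) * (1 + r * y) / ((1 - y ^ 2) * (1 - r ^ 2 * y ^ 2)) =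
      (1 - a * y) * (1 - b * y) / (1 - y ^ 2) := by
    intro y hy
    rw [← mul_div_mul_right _ (1 - y ^ 2) hy]
    congr 1
    ring
  refine Eq.trans ?_ (kw_main N hN x a b t ht0 ht1 hx hinj hxx htx htx')
  refine Finset.sum_congr rfl fun i _ => ?_
  rw [Finset.sum_pair (by norm_num)]
  have e1 : x i ^ (2 * 1 : ℤ) = x i ^ 2 := by norm_cast
  have e2 : x i ^ (2 * (-1) : ℤ) = (x i)⁻¹ ^ 2 := by
    rw [mul_comm, zpow_mul, zpow_neg_one]; norm_cast
  rw [e1, e2, zpow_one, zpow_neg_one, hcancel _ (hrx i), hcancel _ (hrx' i)]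
end
end
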